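/- For every a ∈ ℝ with a not an integer and a ≠ 0, the series ∑_{k=1}^∞ 1/(k² − a²) converges to 1/(2a²) − π·cot(πa)/(2a). -/

import Mathlib

open Real

theorem stmt2 (a : ℝ) (ha : ∀ n : ℤ, a ≠ (n : ℝ)) (ha0 : a ≠ 0) :
    HasSum (fun k : ℕ+ => 1 / ((k : ℝ) ^ 2 - a ^ 2))
      (1 / (2 * a ^ 2) - π * Real.cot (π * a) / (2 * a)) := by
  have hz : (a : ℂ) ∈ Complex.integerComplement := by
    rintro ⟨n, hn⟩
    apply ha n
    have : ((n : ℝ) : ℂ) = (a : ℂ) := by simpa using hn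
    exact (Complex.ofReal_injective this).symm
  have h1 : HasSum (fun n : ℕ => cotTerm (a : ℂ) n)
      (π * Complex.cot (π * a) - 1 / a) :=
    (Summable.hasSum_iff_tendsto_nat (summable_cotTerm hz)).mpr
      (tendsto_logDeriv_euler_cot_sub hz)
  have ha' : (a : ℂ) ≠ 0 := by exact_mod_cast ha0
  have h2 := h1.mul_left (-1 / (2 * (a : ℂ)))
  rw [← Equiv.pnatEquivNat.symm.hasSum_iff, ← Complex.hasSum_ofReal]
  convert h2 using 1
  · rfl
  · funext n
    have p1 : (a : ℂ) + (n + 1) ≠ 0 := by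
      simpa using Complex.integerComplement_add_ne_zero hz (n + 1)
    have p2 : (a : ℂ) - (n + 1) ≠ 0 := by
      simpa [sub_eq_add_neg] using Complex.integerComplement_add_ne_zero hz (-(n + 1))
    have p3 : ((n : ℂ) + 1) ^ 2 - (a : ℂ) ^ 2 ≠ 0 := by
      have := mul_ne_zero p1 p2
      intro h
      apply this
      linear_combination -h
    rw [cotTerm_identity hz]
    simp only [Function.comp, Equiv.pnatEquivNat_symm_apply, Nat.succPNat_coe, Nat.succ_eq_add_one]
    push_cast
    field_simp
    ring
  · push_cast
    field_simp
    ring
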